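/- Let G₁ and G₂ be perfectly-Hopfian groups such that G₁ is incommensurable with G₂ (i.e., the only homomorphism G₁ → G₂ is the trivial one). Then the direct product G₁ × G₂ is perfectly-Hopfian. -/

import Mathlib

/-- A group is perfectly-Hopfian if every endomorphism with normal image and
perfect quotient is an automorphism. -/
def PerfectlyHopfian (G : Type*) [Group G] : Prop :=
  ∀ φ : G →* G, ∀ hn : φ.range.Normal,
    (haveI := hn; commutator (G ⧸ φ.range) = ⊤) → Function.Bijective φ

theorem commutator_eq_top_of_surjective {G H : Type*} [Group G] [Group H] {f : G →* H}
    (hf : Function.Surjective f) (hG : commutator G = ⊤) : commutator H = ⊤ := by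
  rw [commutator_def] at hG ⊢
  rw [← Subgroup.map_top_of_surjective f hf, ← Subgroup.map_commutator, hG]

/-- An endomorphism of a perfectly-Hopfian group is bijective if the quotient by its image is,
through some surjection, an image of a perfect group. -/
theorem PerfectlyHopfian.bijective_of_ker_eq_range {G Q K : Type*} [Group G] [Group Q] [Group K]
    (hG : PerfectlyHopfian G) (φ : G →* G) {p : G →* K} (hker : p.ker = φ.range)
    (hp : Function.Surjective p) {q : Q →* K} (hq : Function.Surjective q)
    (hQ : commutator Q = ⊤) : Function.Bijective φ := by
  have hn : φ.range.Normal := hker ▸ p.normal_ker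
  refine hG φ hn ?_
  let e : K ≃* G ⧸ φ.range := (QuotientGroup.quotientKerEquivOfSurjective p hp).symm.trans
    (QuotientGroup.quotientMulEquivOfEq hker)
  exact commutator_eq_top_of_surjective (f := e.toMonoidHom) e.surjective
    (commutator_eq_top_of_surjective hq hQ)

theorem prod_isPerfectlyHopfian_of_incommensurable (G₁ G₂ : Type*) [Group G₁] [Group G₂]
    (hp₁ : PerfectlyHopfian G₁) (hp₂ : PerfectlyHopfian G₂)
    (hinc : ∀ f : G₁ →* G₂, f = 1) :
    PerfectlyHopfian (G₁ × G₂) := by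
  intro φ hn hperf
  let α : G₁ →* G₁ := (MonoidHom.fst G₁ G₂).comp (φ.comp (MonoidHom.inl G₁ G₂))
  let δ : G₂ →* G₂ := (MonoidHom.snd G₁ G₂).comp (φ.comp (MonoidHom.inr G₁ G₂))
  have hinl (a : G₁) : φ (a, 1) = (α a, 1) :=
    Prod.ext rfl
      (DFunLike.congr_fun (hinc ((MonoidHom.snd G₁ G₂).comp (φ.comp (MonoidHom.inl G₁ G₂)))) a)
  have hsplit (a : G₁) (b : G₂) : φ (a, b) = (α a, 1) * φ (1, b) := by
    rw [← hinl, ← map_mul]; simp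
  have hsnd (a : G₁) (b : G₂) : (φ (a, b)).2 = δ b := by
    rw [hsplit]; simp [δ]
  have hδrange : δ.range = φ.range.map (MonoidHom.snd G₁ G₂) := by
    ext y
    constructor
    · rintro ⟨b, rfl⟩
      exact ⟨φ (1, b), ⟨_, rfl⟩, rfl⟩
    · rintro ⟨_, ⟨⟨a, b⟩, rfl⟩, rfl⟩
      exact ⟨b, (hsnd a b).symm⟩
  have hδ : Function.Bijective δ := by
    have hδn : δ.range.Normal := hδrange ▸ hn.map _ Prod.snd_surjective
    refine hp₂.bijective_of_ker_eq_range δ (QuotientGroup.ker_mk' δ.range)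
      (QuotientGroup.mk'_surjective _)
      (q := QuotientGroup.map φ.range δ.range (MonoidHom.snd G₁ G₂) ?_) ?_ hperf
    · rw [← Subgroup.map_le_iff_le_comap, hδrange]
    · intro y
      obtain ⟨y, rfl⟩ := QuotientGroup.mk_surjective y
      exact ⟨QuotientGroup.mk (1, y), rfl⟩
  have hα : Function.Bijective α := by
    refine hp₁.bijective_of_ker_eq_range α
      (p := (QuotientGroup.mk' φ.range).comp (MonoidHom.inl G₁ G₂)) ?_ ?_
      (q := MonoidHom.id _) Function.surjective_id hperf
    · ext x
      rw [MonoidHom.mem_ker, MonoidHom.comp_apply, ← MonoidHom.mem_ker, QuotientGroup.ker_mk']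
      constructor
      · rintro ⟨⟨a, b⟩, h⟩
        have hb : b = 1 := (map_eq_one_iff δ hδ.1).1 (by rw [← hsnd a b, h]; rfl)
        subst hb
        exact ⟨a, congrArg Prod.fst h⟩
      · rintro ⟨a, rfl⟩
        exact ⟨(a, 1), hinl a⟩
    · intro z
      obtain ⟨⟨x, y⟩, rfl⟩ := QuotientGroup.mk_surjective z
      obtain ⟨b, rfl⟩ := hδ.2 y
      refine ⟨x * (φ (1, b)).1⁻¹, QuotientGroup.eq.2 ⟨(1, b), ?_⟩⟩
      ext <;> simp [hsnd]
  constructor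
  · rw [injective_iff_map_eq_one]
    rintro ⟨a, b⟩ h
    have hb : b = 1 := (map_eq_one_iff δ hδ.1).1 (by rw [← hsnd a b, h]; rfl)
    subst hb
    have ha : a = 1 := (map_eq_one_iff α hα.1).1 (congrArg Prod.fst h)
    rw [ha]; rfl
  · rintro ⟨x, y⟩
    obtain ⟨b, rfl⟩ := hδ.2 y
    obtain ⟨a, ha⟩ := hα.2 (x * (φ (1, b)).1⁻¹)
    refine ⟨(a, b), ?_⟩
    rw [hsplit, ha]
    ext <;> simp [hsnd]
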